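/- Let u be the m-bonacci word for an integer m ≥ 2, and let ⟨n⟩_U denote the normal U-representation of n ≥ 1 in the numeration system with U_j = |σ_m^j(0)|. If ⟨n⟩_U is a prefix of the infinite periodic word (1 0^{m−1})^ω = 1 0^{m−1} 1 0^{m−1} 1 0^{m−1} ⋯, then ρ_u(n) = m. -/

import Mathlib

/-- The m-bonacci substitution on letters. -/
def mbSub (m : ℕ) (ℓ : ℕ) : List ℕ :=
  if ℓ = m - 1 then [0] else [0, ℓ + 1]

/-- Application of the m-bonacci substitution to a word. -/
def mbApply (m : ℕ) (w : List ℕ) : List ℕ := w.flatMap (mbSub m)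

/-- σ_m^k(0). -/
def mbIter (m k : ℕ) : List ℕ := (mbApply m)^[k] [0]

/-- w is a factor of the m-bonacci word. -/
def mbFactor (m : ℕ) (w : List ℕ) : Prop := ∃ k, w <:+: mbIter m k

/-- The prefix of length n of the m-bonacci word. -/
def mbPrefix (m n : ℕ) : List ℕ := (mbIter m n).take n

/-- Abelian complexity: number of distinct Parikh vectors of factors of length n. -/
noncomputable def mbAC (m n : ℕ) : ℕ :=
  Set.ncard ((fun (w : List ℕ) (ℓ : ℕ) => w.count ℓ) ''
    {w : List ℕ | mbFactor m w ∧ w.length = n})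

/-- Tribonacci numbers. -/
def tribN : ℕ → ℕ
  | 0 => 0
  | 1 => 0
  | 2 => 1
  | n + 3 => tribN (n + 2) + tribN (n + 1) + tribN n

/-- Value of a digit string (most significant digit first) in the Tribonacci system. -/
def valT : List ℕ → ℕ
  | [] => 0
  | d :: rest => d * tribN (rest.length + 3) + valT rest

/-- L is the normal T-representation of n (MSB first, greedy). -/
def IsNormalTRep (n : ℕ) (L : List ℕ) : Prop :=
  (∀ d ∈ L, d ≤ 1) ∧ (∀ d ∈ L.take 1, d = 1) ∧ valT L = n ∧
    ∀ S, S <:+ L → valT S < tribN (S.length + 3)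

/-- Value of a digit string (MSB first) in the m-bonacci numeration system U_j = |σ_m^j(0)|. -/
def valU (m : ℕ) : List ℕ → ℕ
  | [] => 0
  | d :: rest => d * (mbIter m rest.length).length + valU m rest

/-- L is the normal U-representation of n (MSB first, greedy) in the m-bonacci system. -/
def IsNormalURep (m n : ℕ) (L : List ℕ) : Prop :=
  (∀ d ∈ L, d ≤ 1) ∧ (∀ d ∈ L.take 1, d = 1) ∧ valU m L = n ∧
    ∀ S, S <:+ L → valU m S < (mbIter m S.length).length

theorem mbApply_append (m : ℕ) (x y : List ℕ) :
    mbApply m (x ++ y) = mbApply m x ++ mbApply m y := by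
  simp [mbApply]

theorem mbApply_cons (m a : ℕ) (x : List ℕ) :
    mbApply m (a :: x) = mbSub m a ++ mbApply m x := by
  simp [mbApply]

theorem List.Perm.mbApply (m : ℕ) {x y : List ℕ} (h : x.Perm y) :
    (_root_.mbApply m x).Perm (_root_.mbApply m y) :=
  List.Perm.flatMap_right _ h

theorem mbIter_succ (m k : ℕ) : mbIter m (k + 1) = mbApply m (mbIter m k) :=
  Function.iterate_succ_apply' _ _ _

theorem mbSub_eq_zero_cons (m a : ℕ) : ∃ t, mbSub m a = 0 :: t := by
  unfold mbSub
  split_ifs <;> simp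

theorem mbApply_eq_zero_cons (m : ℕ) {x : List ℕ} (hx : x ≠ []) :
    ∃ t, mbApply m x = 0 :: t := by
  obtain ⟨a, x, rfl⟩ := List.exists_cons_of_ne_nil hx
  obtain ⟨t, ht⟩ := mbSub_eq_zero_cons m a
  exact ⟨t ++ mbApply m x, by rw [mbApply_cons, ht, List.cons_append]⟩

theorem length_mbApply_le (m : ℕ) (x : List ℕ) : (mbApply m x).length ≤ 2 * x.length := by
  induction x with
  | nil => simp [mbApply]
  | cons a x ih =>
    have : (mbSub m a).length ≤ 2 := by unfold mbSub; split_ifs <;> simp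
    rw [mbApply_cons, List.length_append, List.length_cons]
    omega

theorem lt_of_mem_mbIter {m : ℕ} (hm : 2 ≤ m) (k : ℕ) : ∀ a ∈ mbIter m k, a < m := by
  induction k with
  | zero =>
    intro a ha
    have : a = 0 := by simpa [mbIter] using ha
    omega
  | succ k ih =>
    intro a ha
    rw [mbIter_succ, mbApply, List.mem_flatMap] at ha
    obtain ⟨b, hb, ha⟩ := ha
    have := ih b hb
    unfold mbSub at ha
    split_ifs at ha <;> simp at ha <;> omega

theorem mbFactor.lt_of_mem {m : ℕ} (hm : 2 ≤ m) {w : List ℕ} (hw : mbFactor m w) {a : ℕ}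
    (ha : a ∈ w) : a < m := by
  obtain ⟨k, hk⟩ := hw
  exact lt_of_mem_mbIter hm k a (hk.subset ha)

theorem mbIter_succ_eq_append {m : ℕ} (hm : 2 ≤ m) (k : ℕ) :
    ∃ r, r ≠ [] ∧ mbIter m (k + 1) = mbIter m k ++ r := by
  induction k with
  | zero =>
    refine ⟨[1], by simp, ?_⟩
    have : 0 ≠ m - 1 := by omega
    simp [mbIter, mbApply, mbSub, this]
  | succ k ih =>
    obtain ⟨r, hr, h⟩ := ih
    refine ⟨mbApply m r, ?_, ?_⟩
    · obtain ⟨t, ht⟩ := mbApply_eq_zero_cons m hr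
      simp [ht]
    · rw [mbIter_succ m (k + 1)]
      conv_lhs => rw [h]
      rw [mbApply_append, ← mbIter_succ]

theorem mbIter_add_eq_append {m : ℕ} (hm : 2 ≤ m) (k T : ℕ) :
    ∃ r, T ≤ r.length ∧ mbIter m (k + T) = mbIter m k ++ r := by
  induction T with
  | zero => exact ⟨[], by simp⟩
  | succ T ih =>
    obtain ⟨r, hr, h⟩ := ih
    obtain ⟨r', hr', h'⟩ := mbIter_succ_eq_append hm (k + T)
    have := List.length_pos_iff.mpr hr'
    refine ⟨r ++ r', by rw [List.length_append]; omega, ?_⟩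
    rw [← add_assoc, h', h, List.append_assoc]

theorem mbFactor.exists_append {m : ℕ} (hm : 2 ≤ m) {v : List ℕ} (hv : mbFactor m v) (T : ℕ) :
    ∃ k p s, T ≤ s.length ∧ mbApply m (mbIter m k) = p ++ (v ++ s) := by
  obtain ⟨k, p, s, h⟩ := hv
  obtain ⟨r, hr, h'⟩ := mbIter_add_eq_append hm k (T + 1)
  refine ⟨k + T, p, s ++ r, by rw [List.length_append]; omega, ?_⟩
  rw [← mbIter_succ, add_assoc, h', ← h]
  simp

/-- Any suffix of a substituted word is, up to a missing initial `0`, a substituted suffix. -/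
theorem exists_suffix_of_mbApply_eq_append (m : ℕ) (z p r : List ℕ) (h : mbApply m z = p ++ r) :
    ∃ z', z' <:+ z ∧ (mbApply m z' = r ∨ mbApply m z' = 0 :: r) := by
  induction z generalizing p with
  | nil =>
    refine ⟨[], List.suffix_rfl, Or.inl ?_⟩
    have h' : [] = p ++ r := h
    rw [(List.append_eq_nil_iff.mp h'.symm).2]
    rfl
  | cons a z ih =>
    match p with
    | [] => exact ⟨a :: z, List.suffix_rfl, Or.inl h⟩
    | b :: p =>
      have extend : ∀ q, mbApply m z = q ++ r →
          ∃ z', z' <:+ a :: z ∧ (mbApply m z' = r ∨ mbApply m z' = 0 :: r) := fun q hq =>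
        let ⟨z', hz', h'⟩ := ih q hq
        ⟨z', hz'.trans (List.suffix_cons a z), h'⟩
      rw [mbApply_cons] at h
      by_cases ha : a = m - 1
      · simp only [mbSub, if_pos ha, List.cons_append, List.nil_append, List.cons.injEq] at h
        exact extend p h.2
      · match p with
        | [] =>
          refine ⟨a :: z, List.suffix_rfl, Or.inr ?_⟩
          rw [mbApply_cons]
          simp only [mbSub, if_neg ha, List.cons_append, List.nil_append, List.cons.injEq] at h ⊢
          exact ⟨trivial, h.2⟩
        | c :: p =>
          simp only [mbSub, if_neg ha, List.cons_append, List.nil_append, List.cons.injEq] at h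
          exact extend p h.2.2

theorem mbFactor.mbApply {m : ℕ} {x : List ℕ} (hx : mbFactor m x) :
    mbFactor m (_root_.mbApply m x) := by
  obtain ⟨k, p, s, h⟩ := hx
  refine ⟨k + 1, _root_.mbApply m p, _root_.mbApply m s, ?_⟩
  rw [mbIter_succ, ← h, mbApply_append, mbApply_append]

theorem mbFactor.mbApply_append_zero {m : ℕ} (hm : 2 ≤ m) {x : List ℕ} (hx : mbFactor m x) :
    mbFactor m (_root_.mbApply m x ++ [0]) := by
  obtain ⟨k, p, s, h⟩ := hx
  obtain ⟨r, hr, h'⟩ := mbIter_succ_eq_append hm k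
  obtain ⟨t, ht⟩ := mbApply_eq_zero_cons m (x := s ++ r) (by simp [hr])
  refine ⟨k + 1 + 1, _root_.mbApply m p, t, ?_⟩
  rw [mbIter_succ, h', ← h, List.append_assoc (p ++ x), mbApply_append m (p ++ x),
    mbApply_append, ht]
  simp

/-- The bispecial (palindromic) prefixes of the m-bonacci word. -/
def mbBispecial (m : ℕ) : ℕ → List ℕ
  | 0 => []
  | N + 1 => mbApply m (mbBispecial m N) ++ [0]

theorem mbIter_eq_mbBispecial_append {m : ℕ} (N : ℕ) (hN : N < m) :
    mbIter m N = mbBispecial m N ++ [N] := by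
  induction N with
  | zero => rfl
  | succ N ih =>
    have : N ≠ m - 1 := by omega
    rw [mbIter_succ, ih (by omega), mbApply_append]
    simp [mbBispecial, mbApply, mbSub, this]

theorem mbBispecial_add {m : ℕ} (hm : 2 ≤ m) (j : ℕ) :
    mbBispecial m (m + j) = mbIter m (m + j) ++ mbBispecial m j := by
  induction j with
  | zero =>
    obtain ⟨M, rfl⟩ : ∃ M, m = M + 1 := ⟨m - 1, by omega⟩
    rw [add_zero, mbIter_succ, mbIter_eq_mbBispecial_append M (by omega), mbApply_append]
    simp [mbBispecial, mbApply, mbSub]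
  | succ j ih =>
    rw [← add_assoc, mbBispecial, ih, mbApply_append, mbIter_succ, mbBispecial, List.append_assoc]

theorem valU_replicate_zero_append (m a : ℕ) (L : List ℕ) :
    valU m (List.replicate a 0 ++ L) = valU m L := by
  induction a with
  | zero => simp
  | succ a ih => simp [List.replicate_succ, valU, ih]

theorem valU_eq_length_mbBispecial {m : ℕ} (hm : 2 ≤ m) (k : ℕ) (L : List ℕ) (hL : L ≠ [])
    (h : L <+: (List.replicate k (1 :: List.replicate (m - 1) 0)).flatten) :
    valU m L = (mbBispecial m (L.length - 1)).length + 1 := by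
  induction k generalizing L with
  | zero => simp at h; contradiction
  | succ k ih =>
    rw [List.replicate_succ, List.flatten_cons] at h
    rcases le_total L.length (1 :: List.replicate (m - 1) 0).length with hle | hle
    · have h' := List.prefix_of_prefix_length_le h (List.prefix_append _ _) hle
      obtain ⟨a, L, rfl⟩ := List.exists_cons_of_ne_nil hL
      rw [List.cons_prefix_cons, List.prefix_replicate_iff] at h'
      obtain ⟨rfl, hj, hL'⟩ := h'
      have hzero := valU_replicate_zero_append m L.length []
      rw [List.append_nil, ← hL'] at hzero
      rw [valU, hzero, mbIter_eq_mbBispecial_append _ (by omega)]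
      simp [valU]
    · obtain ⟨L', rfl⟩ := List.prefix_of_prefix_length_le (List.prefix_append _ _) h hle
      rw [List.prefix_append_right_inj] at h
      rcases eq_or_ne L' [] with rfl | hL'
      · have hzero := valU_replicate_zero_append m (m - 1) []
        rw [List.append_nil] at hzero
        rw [List.append_nil, valU, hzero, List.length_replicate, mbIter_eq_mbBispecial_append _ (by omega)]
        simp [valU]
      · obtain ⟨j, hj⟩ := Nat.exists_eq_add_of_lt (List.length_pos_iff.mpr hL')
        have hlen : (m - 1) + L'.length = m + j := by omega
        have hval := ih L' hL' h
        rw [show L'.length - 1 = j by omega] at hval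
        rw [List.cons_append, valU, valU_replicate_zero_append, hval, List.length_cons,
          List.length_append, List.length_replicate, Nat.add_sub_cancel, hlen,
          mbBispecial_add hm j, List.length_append]
        omega

theorem exists_eq_append_of_append_eq_append {α : Type*} {a b c d : List α}
    (h : a ++ b = c ++ d) (hle : a.length ≤ c.length) : ∃ e, c = a ++ e ∧ b = e ++ d := by
  obtain ⟨e, rfl⟩ := List.prefix_of_prefix_length_le (List.prefix_append a b)
    (h ▸ List.prefix_append c d) hle
  exact ⟨e, rfl, by simpa using h⟩

theorem perm_cons_mbBispecial_of_mbFactor {m : ℕ} (hm : 2 ≤ m) (N : ℕ) {v : List ℕ}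
    (hv : mbFactor m v) (hlen : v.length = (mbBispecial m N).length + 1) :
    ∃ i < m, v.Perm (i :: mbBispecial m N) := by
  induction N generalizing v with
  | zero =>
    obtain ⟨i, rfl⟩ := List.length_eq_one_iff.mp hlen
    exact ⟨i, hv.lt_of_mem hm (by simp), List.Perm.refl _⟩
  | succ N ih =>
    set w := mbBispecial m N with hw
    have hlen' : v.length = (mbApply m w).length + 2 := by
      simpa [mbBispecial] using hlen
    obtain ⟨k, p, s, hs, h⟩ := hv.exists_append hm (2 * (w.length + 2))
    obtain ⟨z, hz, hzr⟩ := exists_suffix_of_mbApply_eq_append m _ p _ h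
    have hzl : w.length + 1 < z.length := by
      have := length_mbApply_le m z
      rcases hzr with e | e <;> rw [e] at this <;> simp at this <;> omega
    obtain ⟨i, him, hi⟩ := ih (v := z.take (w.length + 1))
      ⟨k, (List.take_prefix _ _).isInfix.trans hz.isInfix⟩ (by rw [List.length_take]; omega)
    obtain ⟨q, hq⟩ := mbApply_eq_zero_cons m (x := z.drop (w.length + 1))
      (by rw [ne_eq, List.drop_eq_nil_iff]; omega)
    have hsplit : mbApply m z = mbApply m (z.take (w.length + 1)) ++ 0 :: q := by
      rw [← hq, ← mbApply_append, List.take_append_drop]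
    have hperm := hi.mbApply m
    obtain ⟨y, hy⟩ := mbApply_eq_zero_cons m (x := z.take (w.length + 1))
      (by rw [ne_eq, ← List.length_eq_zero_iff, List.length_take]; omega)
    rw [hy] at hsplit hperm
    have hylen := hperm.length_eq
    rw [mbApply_cons] at hperm hylen
    have hmem : ∀ d ∈ v, d < m := fun d hd => hv.lt_of_mem hm hd
    rw [mbBispecial, ← hw]
    by_cases hi1 : i = m - 1
    · simp only [mbSub, if_pos hi1, List.cons_append, List.nil_append, List.length_cons,
        List.perm_cons] at hperm hylen
      rcases hzr with e | e
      · obtain ⟨E, rfl, -⟩ := exists_eq_append_of_append_eq_append (hsplit.symm.trans e)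
          (by rw [List.length_cons]; omega)
        obtain ⟨d, rfl⟩ : ∃ d, E = [d] := List.length_eq_one_iff.mp (by simp at hlen'; omega)
        refine ⟨d, hmem d (by simp), (List.perm_append_singleton _ _).trans (.cons _ ?_)⟩
        exact (hperm.cons 0).trans (List.perm_append_singleton _ _).symm
      · rw [hsplit, List.cons_append, List.cons_inj_right] at e
        obtain ⟨E, rfl, hE⟩ := exists_eq_append_of_append_eq_append e (by omega)
        obtain ⟨c, d, rfl⟩ : ∃ c d, E = [c, d] :=
          List.length_eq_two.mp (by simp at hlen'; omega)
        obtain rfl : 0 = c := (List.cons.inj hE).1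
        refine ⟨d, hmem d (by simp), ?_⟩
        rw [List.append_cons]
        exact (List.perm_append_singleton _ _).trans (.cons _ (hperm.append_right [0]))
    · simp only [mbSub, if_neg hi1, List.cons_append, List.nil_append, List.length_cons,
        List.perm_cons] at hperm hylen
      refine ⟨i + 1, by omega, ?_⟩
      rcases hzr with e | e
      · obtain ⟨E, rfl, -⟩ := exists_eq_append_of_append_eq_append (hsplit.symm.trans e)
          (by rw [List.length_cons]; omega)
        obtain rfl : E = [] := List.length_eq_zero_iff.mp (by simp at hlen'; omega)
        rw [List.append_nil]
        exact (List.perm_append_singleton _ _).symm.trans (hperm.append_right [0])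
      · rw [hsplit, List.cons_append, List.cons_inj_right] at e
        obtain ⟨E, rfl, hE⟩ := exists_eq_append_of_append_eq_append e (by omega)
        obtain ⟨c, rfl⟩ : ∃ c, E = [c] := List.length_eq_one_iff.mp (by simp at hlen'; omega)
        obtain rfl : 0 = c := (List.cons.inj hE).1
        exact hperm.append_right [0]

theorem exists_mbFactor_perm_cons_mbBispecial {m : ℕ} (hm : 2 ≤ m) (N i : ℕ) (hi : i < m) :
    ∃ v, mbFactor m v ∧ v.Perm (i :: mbBispecial m N) := by
  induction N generalizing i with
  | zero =>
    refine ⟨[i], ⟨i, ?_⟩, List.Perm.refl _⟩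
    rw [mbIter_eq_mbBispecial_append i hi]
    exact (List.suffix_append _ _).isInfix
  | succ N ih =>
    cases i with
    | zero =>
      obtain ⟨v, hv, hp⟩ := ih (m - 1) (by omega)
      refine ⟨_, hv.mbApply_append_zero hm, ?_⟩
      refine ((hp.mbApply m).append_right [0]).trans ?_
      simp [mbApply_cons, mbSub, mbBispecial]
    | succ i =>
      obtain ⟨v, hv, hp⟩ := ih i (by omega)
      refine ⟨_, hv.mbApply, (hp.mbApply m).trans ?_⟩
      have : i ≠ m - 1 := by omega
      simp only [mbApply_cons, mbSub, mbBispecial, if_neg this, List.cons_append, List.nil_append]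
      exact (List.Perm.swap _ _ _).trans ((List.perm_append_singleton _ _).symm.cons _)

theorem mbonacci_abelian_complexity_eq_m_of_prefix (m : ℕ) (hm : 2 ≤ m)
    (n : ℕ) (hn : 1 ≤ n) (L : List ℕ) (hL : IsNormalURep m n L)
    (hpre : ∃ k, L <+: (List.replicate k (1 :: List.replicate (m - 1) 0)).flatten) :
    mbAC m n = m := by
  obtain ⟨k, hk⟩ := hpre
  have hval : valU m L = n := hL.2.2.1
  have hne : L ≠ [] := by
    rintro rfl
    simp only [valU] at hval
    omega
  rw [valU_eq_length_mbBispecial hm k L hne hk] at hval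
  generalize L.length - 1 = N at hval
  have himage : (fun (w : List ℕ) (ℓ : ℕ) => w.count ℓ) '' {w | mbFactor m w ∧ w.length = n} =
      (fun (i ℓ : ℕ) => (i :: mbBispecial m N).count ℓ) '' (Finset.range m : Set ℕ) := by
    ext f
    constructor
    · rintro ⟨v, ⟨hv, hlen⟩, rfl⟩
      obtain ⟨i, hi, hp⟩ := perm_cons_mbBispecial_of_mbFactor hm N hv (hlen.trans hval.symm)
      exact ⟨i, by simpa using hi, funext fun ℓ => (hp.count_eq ℓ).symm⟩
    · rintro ⟨i, hi, rfl⟩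
      obtain ⟨v, hv, hp⟩ := exists_mbFactor_perm_cons_mbBispecial hm N i (by simpa using hi)
      exact ⟨v, ⟨hv, by rw [hp.length_eq, ← hval, List.length_cons]⟩,
        funext fun ℓ => hp.count_eq ℓ⟩
  have hinj : Function.Injective fun (i ℓ : ℕ) => (i :: mbBispecial m N).count ℓ := by
    intro i j hij
    have := congrFun hij i
    simp only [List.count_cons, beq_self_eq_true, if_true] at this
    by_contra hne
    have : (j == i) = false := by simpa using Ne.symm hne
    simp_all
  rw [mbAC, himage, Set.ncard_image_of_injective _ hinj, Set.ncard_coe_finset, Finset.card_range]
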